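/- Let N be a positive integer and regard N-th order three-dimensional complex matrices as families A = (A_{ijk}) with i,j,k ∈ {1,…,N}. The trilinear ternary product defined by (A⊙B⊙C)_{ijk} = Σ_{l,m,n} A_{ijl} B_{mnl} C_{mnk} is associative of the second kind: (A⊙B⊙C)⊙D⊙F = A⊙(D⊙C⊙B)⊙F = A⊙B⊙(C⊙D⊙F) for all three-dimensional matrices A, B, C, D, F of order N. -/

import Mathlib

open Finset

/-- Ternary product number 4 (in the sense of Abramov–Kerner–Liivapuu–Shitov) of
three-dimensional complex matrices of order `N`:
`(A ⊙ B ⊙ C)_{ijk} = A i j l * B m n l * C m n k` (summation over `l, m, n`). -/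
noncomputable def tprod3 {N : ℕ} (A B C : Fin N → Fin N → Fin N → ℂ) :
    Fin N → Fin N → Fin N → ℂ :=
  fun i j k => ∑ l, ∑ m, ∑ n, A i j l * B m n l * C m n k

/-- The flattening of a three-dimensional matrix that groups its first two indices. -/
def flattenRows {N : ℕ} (A : Fin N → Fin N → Fin N → ℂ) : Matrix (Fin N × Fin N) (Fin N) ℂ :=
  Matrix.of fun p l => A p.1 p.2 l

theorem flattenRows_injective {N : ℕ} : Function.Injective (flattenRows (N := N)) := by
  intro A B h
  funext i j k
  exact congrFun (congrFun h (i, j)) k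

theorem flattenRows_tprod3 {N : ℕ} (A B C : Fin N → Fin N → Fin N → ℂ) :
    flattenRows (tprod3 A B C) =
      flattenRows A * ((flattenRows B).transpose * flattenRows C) := by
  ext p k
  simp [flattenRows, tprod3, Matrix.mul_apply, Fintype.sum_prod_type, Finset.mul_sum, mul_assoc]

/-- this ternary product of three-dimensional matrices is associative
of the second kind. -/
theorem tprod_assoc_second_kind {N : ℕ} (hN : 0 < N)
    (A B C D F : Fin N → Fin N → Fin N → ℂ) :
    tprod3 (tprod3 A B C) D F = tprod3 A (tprod3 D C B) F ∧
    tprod3 A (tprod3 D C B) F = tprod3 A B (tprod3 C D F) := by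
  constructor <;>
    exact flattenRows_injective <| by
      simp only [flattenRows_tprod3, Matrix.transpose_mul, Matrix.transpose_transpose,
        Matrix.mul_assoc]
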